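/- arXiv:2204.13209 — 3 statements merged into one kernel-verified Lean document; each statement's English description precedes it below -/
import Mathlib

section
/- Let 𝒮 ⊆ ℝⁿ be a convex set partitioned into finitely many pairwise disjoint convex sets 𝒮₁,…,𝒮_R each with nonempty interior, and let F : 𝒮 → ℝᵐ be continuous with F(x) = G_i x + g_i for all x ∈ 𝒮_i (G_i ∈ ℝ^{m×n}, g_i ∈ ℝᵐ). Then for any α ∈ {1,∞}, the local α-Lipschitz constant of F over 𝒮, sup_{x≠y∈𝒮} ‖F(x)−F(y)‖_α / ‖x−y‖_α, is finite and equals max_{1≤i≤R} ‖G_i‖_α, where ‖G_i‖_α is the operator norm of G_i induced by the α-norms on ℝⁿ and ℝᵐ. -/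
/-- The 1-norm on `Fin k → ℝ`. -/
def norm1 {k : ℕ} (x : Fin k → ℝ) : ℝ := ∑ i, |x i|

/-- The ∞-norm on `Fin k → ℝ`. -/
noncomputable def normInf {k : ℕ} (x : Fin k → ℝ) : ℝ := ⨆ i, |x i|

/-- The set of difference quotients of `F` over `S`, whose supremum is the local
Lipschitz constant of `F` on `S` w.r.t. the norm `nrm`. -/
def lipRatios {n m : ℕ} (nrm : ∀ k : ℕ, (Fin k → ℝ) → ℝ)
    (F : (Fin n → ℝ) → (Fin m → ℝ)) (S : Set (Fin n → ℝ)) : Set ℝ :=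
  {r | ∃ x ∈ S, ∃ y ∈ S, x ≠ y ∧ r = nrm m (F x - F y) / nrm n (x - y)}

/-- The operator norm of a matrix induced by the norm `nrm` on both domain and codomain. -/
noncomputable def inducedNorm {n m : ℕ} (nrm : ∀ k : ℕ, (Fin k → ℝ) → ℝ)
    (G : Matrix (Fin m) (Fin n) ℝ) : ℝ :=
  sSup {r | ∃ x : Fin n → ℝ, x ≠ 0 ∧ r = nrm m (G.mulVec x) / nrm n x}

/-- The properties of the 1-norm and ∞-norm used in the proof. -/
structure GoodNorm (nrm : ∀ k : ℕ, (Fin k → ℝ) → ℝ) : Prop where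
  nonneg : ∀ k x, 0 ≤ nrm k x
  add_le : ∀ k x y, nrm k (x + y) ≤ nrm k x + nrm k y
  smul_eq : ∀ k (c : ℝ) x, nrm k (c • x) = |c| * nrm k x
  coord_le : ∀ k x i, |x i| ≤ nrm k x
  le_sum : ∀ k x, nrm k x ≤ ∑ i, |x i|

theorem goodNorm_of {nrm : ∀ k : ℕ, (Fin k → ℝ) → ℝ}
    (hnrm : (∀ (k : ℕ) (x : Fin k → ℝ), nrm k x = norm1 x) ∨
            (∀ (k : ℕ) (x : Fin k → ℝ), nrm k x = normInf x)) : GoodNorm nrm := by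
  rcases hnrm with h | h
  · refine ⟨?_, ?_, ?_, ?_, ?_⟩
    · intro k x
      rw [h]
      exact Finset.sum_nonneg fun i _ => abs_nonneg _
    · intro k x y
      simp only [h, norm1, ← Finset.sum_add_distrib]
      exact Finset.sum_le_sum fun i _ => abs_add_le _ _
    · intro k c x
      simp [h, norm1, Finset.mul_sum, abs_mul]
    · intro k x i
      rw [h]
      exact Finset.single_le_sum (f := fun i => |x i|) (fun i _ => abs_nonneg _) (Finset.mem_univ i)
    · intro k x
      rw [h]
      exact le_rfl
  · have hc : ∀ (k : ℕ) (x : Fin k → ℝ) i, |x i| ≤ nrm k x := by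
      intro k x i
      rw [h]
      exact le_ciSup (f := fun i => |x i|) (Set.finite_range _).bddAbove i
    have h0 : ∀ (k : ℕ) (x : Fin k → ℝ), 0 ≤ nrm k x := by
      intro k x
      rw [h]
      exact Real.iSup_nonneg fun i => abs_nonneg _
    refine ⟨h0, ?_, ?_, hc, ?_⟩
    · intro k x y
      rw [h k (x + y)]
      refine Real.iSup_le (fun i => ?_) (add_nonneg (h0 _ _) (h0 _ _))
      exact (abs_add_le _ _).trans (add_le_add (hc _ _ _) (hc _ _ _))
    · intro k c x
      simp only [h, normInf, Pi.smul_apply, smul_eq_mul, abs_mul]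
      exact (Real.mul_iSup_of_nonneg (abs_nonneg c) _).symm
    · intro k x
      rw [h]
      refine Real.iSup_le (fun i => ?_) (Finset.sum_nonneg fun i _ => abs_nonneg _)
      exact Finset.single_le_sum (f := fun i => |x i|) (fun i _ => abs_nonneg _) (Finset.mem_univ i)

theorem GoodNorm.pos {nrm : ∀ k : ℕ, (Fin k → ℝ) → ℝ} (h : GoodNorm nrm) {k : ℕ}
    {x : Fin k → ℝ} (hx : x ≠ 0) : 0 < nrm k x := by
  obtain ⟨i, hi⟩ := Function.ne_iff.mp hx
  exact (abs_pos.mpr hi).trans_le (h.coord_le k x i)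

theorem GoodNorm.mulVec_le {nrm : ∀ k : ℕ, (Fin k → ℝ) → ℝ} (h : GoodNorm nrm) {n m : ℕ}
    (G : Matrix (Fin m) (Fin n) ℝ) (x : Fin n → ℝ) :
    nrm m (G.mulVec x) ≤ inducedNorm nrm G * nrm n x := by
  by_cases hx : x = 0
  · subst hx
    have h1 := h.smul_eq n 0 0
    have h2 := h.smul_eq m 0 0
    simp only [smul_zero, abs_zero, zero_mul] at h1 h2
    rw [Matrix.mulVec_zero, h1, h2, mul_zero]
  · rw [← div_le_iff₀ (h.pos hx)]
    refine le_csSup ⟨∑ i, ∑ j, |G i j|, ?_⟩ ⟨x, hx, rfl⟩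
    rintro r ⟨y, hy, rfl⟩
    rw [div_le_iff₀ (h.pos hy)]
    refine (h.le_sum _ _).trans ?_
    rw [Finset.sum_mul]
    refine Finset.sum_le_sum fun i _ => ?_
    rw [Finset.sum_mul]
    refine (Finset.abs_sum_le_sum_abs (fun j => G i j * y j) Finset.univ).trans ?_
    refine Finset.sum_le_sum fun j _ => ?_
    rw [abs_mul]
    exact mul_le_mul_of_nonneg_left (h.coord_le _ _ _) (abs_nonneg _)

/-- A function on an interval covered by finitely many closed sets, on each of which it is
`K`-Lipschitz, satisfies the `K`-Lipschitz estimate between the end points. -/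
theorem walk {m : ℕ} {ι : Type*} [DecidableEq ι] (N : (Fin m → ℝ) → ℝ)
    (hN : ∀ x y, N (x + y) ≤ N x + N y) (f : ℝ → Fin m → ℝ) (K : ℝ) (T : ι → Set ℝ)
    (hT : ∀ i, IsClosed (T i))
    (hL : ∀ i, ∀ a ∈ T i, ∀ b ∈ T i, a ≤ b → N (f b - f a) ≤ K * (b - a)) (b : ℝ) :
    ∀ (c : ℕ) (s : Finset ι), s.card = c → ∀ a ≤ b, Set.Icc a b ⊆ (⋃ i ∈ s, T i) →
      N (f b - f a) ≤ K * (b - a) := by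
  intro c
  induction c with
  | zero =>
    intro s hs a hab hcov
    rw [Finset.card_eq_zero] at hs
    subst hs
    have := hcov (Set.left_mem_Icc.mpr hab)
    simp at this
  | succ c ih =>
    intro s hs a hab hcov
    have ha := hcov (Set.left_mem_Icc.mpr hab)
    simp only [Set.mem_iUnion] at ha
    obtain ⟨i, his, hai⟩ := ha
    obtain ⟨d, ⟨hdT, hd⟩, hmax⟩ := (isCompact_Icc (a := a) (b := b) |>.inter_left
      (hT i)).exists_isGreatest ⟨a, hai, Set.left_mem_Icc.mpr hab⟩
    have h1 := hL i a hai d hdT hd.1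
    rcases hd.2.eq_or_lt with rfl | hlt
    · exact h1
    have hsub : Set.Icc d b ⊆ ⋃ j ∈ s.erase i, T j := by
      rw [← closure_Ioc hlt.ne]
      refine closure_minimal ?_ ((s.erase i).finite_toSet.isClosed_biUnion fun j _ => hT j)
      intro t ht
      have htab : t ∈ Set.Icc a b := ⟨hd.1.trans ht.1.le, ht.2⟩
      have h2 := hcov htab
      simp only [Set.mem_iUnion] at h2 ⊢
      obtain ⟨j, hj, htj⟩ := h2
      refine ⟨j, Finset.mem_erase.mpr ⟨?_, hj⟩, htj⟩
      rintro rfl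
      exact absurd (hmax ⟨htj, htab⟩) (not_le.mpr ht.1)
    have h2 := ih (s.erase i) (by rw [Finset.card_erase_of_mem his, hs]; rfl) d hd.2 hsub
    have h3 := hN (f b - f d) (f d - f a)
    rw [sub_add_sub_cancel] at h3
    linarith

/-- Let `𝒮 ⊆ ℝⁿ` be convex and partitioned into finitely many pairwise disjoint convex sets
`𝒮₁, …, 𝒮_R`, each with nonempty interior, and let `F : 𝒮 → ℝᵐ` be continuous with
`F(x) = Gᵢ x + gᵢ` on `𝒮ᵢ`.  Then for `α ∈ {1, ∞}`, the local `α`-Lipschitz constant of `F`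
over `𝒮` is finite (the set of difference quotients is bounded above) and equals
`max_{1 ≤ i ≤ R} ‖Gᵢ‖_α`, the largest of the induced matrix norms of the `Gᵢ`. -/
theorem stmt2 {n m R : ℕ} (hR : 0 < R)
    (nrm : ∀ k : ℕ, (Fin k → ℝ) → ℝ)
    (hnrm : (∀ (k : ℕ) (x : Fin k → ℝ), nrm k x = norm1 x) ∨
            (∀ (k : ℕ) (x : Fin k → ℝ), nrm k x = normInf x))
    (S : Set (Fin n → ℝ)) (hSconv : Convex ℝ S)
    (Si : Fin R → Set (Fin n → ℝ))
    (hconv : ∀ i, Convex ℝ (Si i))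
    (hint : ∀ i, (interior (Si i)).Nonempty)
    (hdisj : ∀ i j, i ≠ j → Si i ∩ Si j = ∅)
    (hcover : S = ⋃ i, Si i)
    (F : (Fin n → ℝ) → (Fin m → ℝ)) (hF : ContinuousOn F S)
    (G : Fin R → Matrix (Fin m) (Fin n) ℝ) (g : Fin R → Fin m → ℝ)
    (haff : ∀ i, ∀ x ∈ Si i, F x = (G i).mulVec x + g i) :
    BddAbove (lipRatios nrm F S) ∧
      sSup (lipRatios nrm F S) = ⨆ i : Fin R, inducedNorm nrm (G i) := by
  classical
  have hg := goodNorm_of hnrm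
  have hI0 : ∀ i, 0 ≤ inducedNorm nrm (G i) := by
    intro i
    refine Real.sSup_nonneg ?_
    rintro r ⟨x, -, rfl⟩
    exact div_nonneg (hg.nonneg _ _) (hg.nonneg _ _)
  have hL0 : 0 ≤ ⨆ i : Fin R, inducedNorm nrm (G i) := Real.iSup_nonneg hI0
  have hIL : ∀ i, inducedNorm nrm (G i) ≤ ⨆ i : Fin R, inducedNorm nrm (G i) := fun i =>
    le_ciSup (f := fun i => inducedNorm nrm (G i)) (Set.finite_range _).bddAbove i
  have hub : ∀ r ∈ lipRatios nrm F S, r ≤ ⨆ i : Fin R, inducedNorm nrm (G i) := by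
    rintro r ⟨y, hy, x, hx, hne, rfl⟩
    rw [div_le_iff₀ (hg.pos (sub_ne_zero.mpr hne))]
    set γ : ℝ → Fin n → ℝ := fun t => x + t • (y - x) with hγ
    have hγc : Continuous γ := by fun_prop
    have hγS : Set.MapsTo γ (Set.Icc 0 1) S := fun t ht =>
      hSconv.add_smul_sub_mem hx hy ht
    have hFγ : ContinuousOn (fun t => F (γ t)) (Set.Icc 0 1) := hF.comp hγc.continuousOn hγS
    have key := walk (nrm m) (hg.add_le m) (fun t => F (γ t))
      ((⨆ i : Fin R, inducedNorm nrm (G i)) * nrm n (y - x))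
      (fun i => {t | t ∈ Set.Icc (0 : ℝ) 1 ∧ F (γ t) = (G i).mulVec (γ t) + g i})
      ?_ ?_ 1 _ Finset.univ rfl 0 zero_le_one ?_
    · simpa [hγ] using key
    · intro i
      have hc : ContinuousOn (fun t => F (γ t) - ((G i).mulVec (γ t) + g i)) (Set.Icc 0 1) := by
        refine hFγ.sub (Continuous.continuousOn ?_)
        exact (continuous_const.matrix_mulVec hγc).add continuous_const
      have := hc.preimage_isClosed_of_isClosed isClosed_Icc (isClosed_singleton (x := 0))
      convert this using 1
      ext t
      simp [sub_eq_zero]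
    · rintro i a ⟨-, ha⟩ b ⟨-, hb⟩ hab
      have h1 : F (γ b) - F (γ a) = (b - a) • (G i).mulVec (y - x) := by
        rw [ha, hb, add_sub_add_right_eq_sub, ← Matrix.mulVec_sub, ← Matrix.mulVec_smul]
        congr 1
        simp only [hγ]
        module
      simp only [h1, hg.smul_eq, abs_of_nonneg (sub_nonneg.mpr hab)]
      rw [mul_comm]
      refine mul_le_mul_of_nonneg_right ?_ (sub_nonneg.mpr hab)
      exact (hg.mulVec_le _ _).trans (mul_le_mul_of_nonneg_right (hIL i) (hg.nonneg _ _))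
    · intro t ht
      have h1 := hγS ht
      rw [hcover] at h1
      obtain ⟨i, hi⟩ := Set.mem_iUnion.mp h1
      simp only [Set.mem_iUnion]
      exact ⟨i, Finset.mem_univ i, ht, haff i _ hi⟩
  have hbdd : BddAbove (lipRatios nrm F S) := ⟨_, hub⟩
  have hs0 : 0 ≤ sSup (lipRatios nrm F S) := by
    refine Real.sSup_nonneg ?_
    rintro r ⟨x, -, y, -, -, rfl⟩
    exact div_nonneg (hg.nonneg _ _) (hg.nonneg _ _)
  refine ⟨hbdd, le_antisymm (Real.sSup_le hub hL0) ?_⟩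
  refine Real.iSup_le (fun i => Real.sSup_le ?_ hs0) hs0
  rintro r ⟨x, hx, rfl⟩
  refine le_csSup hbdd ?_
  obtain ⟨p, hp⟩ := hint i
  have hpc : Continuous fun t : ℝ => p + t • x := by fun_prop
  have hev : ∀ᶠ t in nhds (0 : ℝ), p + t • x ∈ Si i := by
    refine hpc.continuousAt.eventually_mem ?_
    simpa using mem_interior_iff_mem_nhds.mp hp
  obtain ⟨ε, hε, hball⟩ := Metric.eventually_nhds_iff.mp hev
  have hε2 : 0 < ε / 2 := half_pos hε
  have hq : p + (ε / 2) • x ∈ Si i := hball (by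
    rw [Real.dist_eq, sub_zero, abs_of_pos hε2]
    linarith)
  have hpS := interior_subset hp
  refine ⟨p + (ε / 2) • x, hcover ▸ Set.mem_iUnion.mpr ⟨i, hq⟩, p,
    hcover ▸ Set.mem_iUnion.mpr ⟨i, hpS⟩, ?_, ?_⟩
  · simp [hε2.ne', hx]
  · rw [haff i _ hq, haff i _ hpS, add_sub_add_right_eq_sub, ← Matrix.mulVec_sub,
      add_sub_cancel_left, Matrix.mulVec_smul, hg.smul_eq, hg.smul_eq,
      mul_div_mul_left _ _ (abs_pos.mpr hε2.ne').ne']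
end

section
/- Let S = {x ∈ ℝⁿ : Fx ≤ 𝟏} be compact with 0 in its interior and gauge Ψ(x) = max_{1≤j≤p} F_{j,:}x, let A(w) = Σ_i w_i A_i, B(w) = Σ_i w_i B_i for w in the simplex W, and let Φ satisfy the contraction condition Ψ(A(w)x + B(w)Φ(x)) ≤ λΨ(x) on S with λ ∈ (0,1). Let Φ_NN : ℝⁿ → ℝᵐ satisfy ‖Φ(x) − Φ_NN(x)‖_∞ ≤ ē for all x ∈ S, and set τ = ‖F‖_∞ · max_{1≤i≤M} ‖B_i‖_∞ (induced ∞-norms). If b satisfies τē/(1−λ) < b ≤ 1, then for every x with Ψ(x) ≤ b and every w ∈ W, Ψ(A(w)x + B(w)Φ_NN(x)) < b; that is, the sublevel set bS is robustly positively invariant for the closed loop with the approximate controller. -/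
/-- The polyhedral set `S = {x ∈ ℝⁿ | F x ≤ 𝟏}` (componentwise). -/
def polySet {p n : ℕ} (F : Matrix (Fin p) (Fin n) ℝ) : Set (Fin n → ℝ) :=
  {x | ∀ j, F.mulVec x j ≤ 1}

/-- The polyhedral gauge function `Ψ(x) = max_{1 ≤ j ≤ p} F_{j,:} x`. -/
noncomputable def gaugeFn {p n : ℕ} (F : Matrix (Fin p) (Fin n) ℝ) (x : Fin n → ℝ) : ℝ :=
  ⨆ j, F.mulVec x j

/-- The uncertainty simplex `W = {w ∈ ℝ^M | Σᵢ wᵢ = 1, w ≥ 0}`. -/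
def simplexW (M : ℕ) : Set (Fin M → ℝ) := {w | ∑ i, w i = 1 ∧ ∀ i, 0 ≤ w i}

/-- The operator norm of a matrix induced by the `∞`-norms (the sup norms on the
function spaces `Fin b → ℝ` and `Fin a → ℝ`). -/
noncomputable def opNormInf {a b : ℕ} (A : Matrix (Fin a) (Fin b) ℝ) : ℝ :=
  ‖LinearMap.toContinuousLinearMap (Matrix.toLin' A)‖

theorem opNormInf_mulVec_le {a b : ℕ} (A : Matrix (Fin a) (Fin b) ℝ) (v : Fin b → ℝ) :
    ‖A.mulVec v‖ ≤ opNormInf A * ‖v‖ :=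
  (LinearMap.toContinuousLinearMap (Matrix.toLin' A)).le_opNorm v

theorem opNormInf_nn {a b : ℕ} (A : Matrix (Fin a) (Fin b) ℝ) : 0 ≤ opNormInf A :=
  norm_nonneg _

theorem le_gaugeFn {p n : ℕ} (F : Matrix (Fin p) (Fin n) ℝ) (x : Fin n → ℝ) (j : Fin p) :
    F.mulVec x j ≤ gaugeFn F x :=
  le_ciSup (f := fun j => F.mulVec x j) (Set.finite_range _).bddAbove j

/-- If `Φ` satisfies the contraction condition with factor `λ ∈ (0,1)` on `S`,
`Φ_NN` approximates `Φ` with worst-case `∞`-norm error `ē` on `S`,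
`τ = ‖F‖_∞ · maxᵢ ‖Bᵢ‖_∞` and `τē/(1−λ) < b ≤ 1`, then the sublevel set
`bS = {x | Ψ(x) ≤ b}` is robustly positively invariant for the closed loop with `Φ_NN`:
`Ψ(A(w)x + B(w)Φ_NN(x)) < b` whenever `Ψ(x) ≤ b` and `w ∈ W`. -/
theorem stmt4 {n m p M : ℕ} (hp : 0 < p) (hM : 0 < M)
    (F : Matrix (Fin p) (Fin n) ℝ)
    (hcomp : IsCompact (polySet F))
    (h0 : (0 : Fin n → ℝ) ∈ interior (polySet F))
    (A : Fin M → Matrix (Fin n) (Fin n) ℝ) (B : Fin M → Matrix (Fin n) (Fin m) ℝ)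
    (Φ ΦNN : (Fin n → ℝ) → (Fin m → ℝ)) (lam ebar τ b : ℝ)
    (hlam0 : 0 < lam) (hlam1 : lam < 1)
    (hΦ : ∀ x ∈ polySet F, ∀ w ∈ simplexW M,
      gaugeFn F ((∑ i, w i • A i).mulVec x + (∑ i, w i • B i).mulVec (Φ x))
        ≤ lam * gaugeFn F x)
    (herr : ∀ x ∈ polySet F, ‖Φ x - ΦNN x‖ ≤ ebar)
    (hτ : τ = opNormInf F * ⨆ i, opNormInf (B i))
    (hb : τ * ebar / (1 - lam) < b) (hb1 : b ≤ 1) :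
    ∀ x : Fin n → ℝ, gaugeFn F x ≤ b → ∀ w ∈ simplexW M,
      gaugeFn F ((∑ i, w i • A i).mulVec x + (∑ i, w i • B i).mulVec (ΦNN x)) < b := by
  intro x hx w hw
  have hxS : x ∈ polySet F := fun j => (le_gaugeFn F x j).trans (hx.trans hb1)
  have h1 := hΦ x hxS w hw
  have he := herr x hxS
  have hβ : ∀ i, opNormInf (B i) ≤ ⨆ i, opNormInf (B i) := fun i =>
    le_ciSup (f := fun i => opNormInf (B i)) (Set.finite_range _).bddAbove i
  generalize (⨆ i, opNormInf (B i)) = β at hτ hβ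
  have hβ0 : 0 ≤ β := (opNormInf_nn (B ⟨0, hM⟩)).trans (hβ _)
  have he0 : 0 ≤ ebar := (norm_nonneg _).trans he
  have hBe : ‖(∑ i, w i • B i).mulVec (Φ x - ΦNN x)‖ ≤ β * ebar := by
    rw [Matrix.sum_mulVec]
    calc _ ≤ ∑ i, ‖(w i • B i).mulVec (Φ x - ΦNN x)‖ := norm_sum_le _ _
      _ ≤ ∑ i, w i * (β * ebar) := by
        refine Finset.sum_le_sum fun i _ => ?_
        rw [Matrix.smul_mulVec, norm_smul, Real.norm_of_nonneg (hw.2 i)]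
        refine mul_le_mul_of_nonneg_left ?_ (hw.2 i)
        exact (opNormInf_mulVec_le _ _).trans
          (mul_le_mul (hβ i) he (norm_nonneg _) hβ0)
      _ = β * ebar := by rw [← Finset.sum_mul, hw.1, one_mul]
  have hlt : lam * b + τ * ebar < b := by
    rw [div_lt_iff₀ (by linarith)] at hb
    linarith
  haveI : Nonempty (Fin p) := ⟨⟨0, hp⟩⟩
  refine lt_of_le_of_lt (ciSup_le fun j => ?_) hlt
  have hz := (le_gaugeFn F _ j).trans (h1.trans (mul_le_mul_of_nonneg_left hx hlam0.le))
  have hn : ‖F.mulVec ((∑ i, w i • B i).mulVec (Φ x - ΦNN x))‖ ≤ τ * ebar := by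
    rw [hτ, mul_assoc]
    exact (opNormInf_mulVec_le _ _).trans
      (mul_le_mul_of_nonneg_left hBe (opNormInf_nn F))
  have hj := (norm_le_pi_norm _ j).trans hn
  rw [Real.norm_eq_abs] at hj
  have hj' := (abs_le.mp hj).1
  simp only [Matrix.mulVec_sub, Matrix.mulVec_add, Pi.add_apply, Pi.sub_apply] at hj' hz ⊢
  linarith
end

section
/- (Proposition 1(ii), trajectory version.) Let A(w) = Σ_i w_i A_i and B(w) = Σ_i w_i B_i for w in the simplex W, and let 𝒟 ⊆ ℝⁿ be positively invariant for the closed loop, i.e., x ∈ 𝒟 and w ∈ W imply A(w)x + B(w)Φ_NN(x) ∈ 𝒟. Suppose there are ϖ ∈ [0,1), L ≥ 0 and β ≥ 0 with ϖ + βL < 1 such that ‖A(w)x + B(w)Φ(x)‖₂ ≤ ϖ‖x‖₂ and ‖Φ(x) − Φ_NN(x)‖₂ ≤ L‖x‖₂ for all x ∈ 𝒟, w ∈ W, and ‖B_i‖₂ ≤ β for all i. Then every trajectory x(k+1) = A(w_k)x(k) + B(w_k)Φ_NN(x(k)) with x(0) ∈ 𝒟 and w_k ∈ W satisfies ‖x(k)‖₂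 ≤ (ϖ + βL)^k ‖x(0)‖₂ for all k ∈ ℕ, so the origin is exponentially stable for the closed loop on 𝒟. -/
/-- The spectral norm of a matrix: the operator norm induced by the Euclidean norms. -/
noncomputable def opNorm2 {a b : ℕ} (A : Matrix (Fin a) (Fin b) ℝ) : ℝ :=
  ‖LinearMap.toContinuousLinearMap (Matrix.toEuclideanLin A)‖

/-- Proposition 1(ii), trajectory version: if `𝒟` is positively invariant for the closed
loop with `Φ_NN`, `‖A(w)x + B(w)Φ(x)‖₂ ≤ ϖ‖x‖₂` and `‖Φ(x) − Φ_NN(x)‖₂ ≤ L‖x‖₂` on `𝒟`,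
`‖Bᵢ‖₂ ≤ β` for all `i`, with `ϖ ∈ [0,1)`, `L, β ≥ 0` and `ϖ + βL < 1`, then every
trajectory `x(k+1) = A(w_k)x(k) + B(w_k)Φ_NN(x(k))` starting in `𝒟` satisfies
`‖x(k)‖₂ ≤ (ϖ + βL)ᵏ ‖x(0)‖₂`: the origin is exponentially stable on `𝒟`. -/
theorem stmt8 {n m M : ℕ}
    (A : Fin M → Matrix (Fin n) (Fin n) ℝ) (B : Fin M → Matrix (Fin n) (Fin m) ℝ)
    (𝒟 : Set (EuclideanSpace ℝ (Fin n)))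
    (Φ ΦNN : EuclideanSpace ℝ (Fin n) → EuclideanSpace ℝ (Fin m))
    (hinv : ∀ x ∈ 𝒟, ∀ w ∈ simplexW M,
      Matrix.toEuclideanLin (∑ i, w i • A i) x
        + Matrix.toEuclideanLin (∑ i, w i • B i) (ΦNN x) ∈ 𝒟)
    (ϖ L β : ℝ) (hϖ0 : 0 ≤ ϖ) (hϖ1 : ϖ < 1) (hL0 : 0 ≤ L) (hβ0 : 0 ≤ β)
    (hcontr : ϖ + β * L < 1)
    (ha : ∀ x ∈ 𝒟, ∀ w ∈ simplexW M,
      ‖Matrix.toEuclideanLin (∑ i, w i • A i) x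
        + Matrix.toEuclideanLin (∑ i, w i • B i) (Φ x)‖ ≤ ϖ * ‖x‖)
    (hL : ∀ x ∈ 𝒟, ‖Φ x - ΦNN x‖ ≤ L * ‖x‖)
    (hβ : ∀ i, opNorm2 (B i) ≤ β)
    (x : ℕ → EuclideanSpace ℝ (Fin n)) (w : ℕ → (Fin M → ℝ))
    (hw : ∀ k, w k ∈ simplexW M)
    (hx0 : x 0 ∈ 𝒟)
    (hdyn : ∀ k, x (k + 1) =
      Matrix.toEuclideanLin (∑ i, w k i • A i) (x k)
        + Matrix.toEuclideanLin (∑ i, w k i • B i) (ΦNN (x k))) :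
    ∀ k : ℕ, ‖x k‖ ≤ (ϖ + β * L) ^ k * ‖x 0‖ := by
  have hB : ∀ v ∈ simplexW M, ∀ u : EuclideanSpace ℝ (Fin m),
      ‖Matrix.toEuclideanLin (∑ i, v i • B i) u‖ ≤ β * ‖u‖ := by
    intro v hv u
    have h1 : ∀ i, ‖Matrix.toEuclideanLin (B i) u‖ ≤ β * ‖u‖ := fun i =>
      ((LinearMap.toContinuousLinearMap (Matrix.toEuclideanLin (B i))).le_opNorm u).trans
        (mul_le_mul_of_nonneg_right (hβ i) (norm_nonneg u))
    have h2 : Matrix.toEuclideanLin (∑ i, v i • B i) u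
        = ∑ i, v i • Matrix.toEuclideanLin (B i) u := by
      simp only [map_sum, map_smul, LinearMap.sum_apply, LinearMap.smul_apply]
    rw [h2]
    calc ‖∑ i, v i • Matrix.toEuclideanLin (B i) u‖
        ≤ ∑ i, ‖v i • Matrix.toEuclideanLin (B i) u‖ := norm_sum_le _ _
      _ ≤ ∑ i, v i * (β * ‖u‖) := by
          refine Finset.sum_le_sum fun i _ => ?_
          rw [norm_smul, Real.norm_of_nonneg (hv.2 i)]
          exact mul_le_mul_of_nonneg_left (h1 i) (hv.2 i)
      _ = β * ‖u‖ := by rw [← Finset.sum_mul, hv.1, one_mul]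
  have hD : ∀ k, x k ∈ 𝒟 := by
    intro k
    induction k with
    | zero => exact hx0
    | succ k ih => rw [hdyn]; exact hinv _ ih _ (hw k)
  have hstep : ∀ k, ‖x (k + 1)‖ ≤ (ϖ + β * L) * ‖x k‖ := by
    intro k
    have e : x (k + 1) = (Matrix.toEuclideanLin (∑ i, w k i • A i) (x k)
        + Matrix.toEuclideanLin (∑ i, w k i • B i) (Φ (x k)))
        - Matrix.toEuclideanLin (∑ i, w k i • B i) (Φ (x k) - ΦNN (x k)) := by
      rw [hdyn, map_sub]; abel
    rw [e]
    have h1 := ha _ (hD k) _ (hw k)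
    have h2 := hB _ (hw k) (Φ (x k) - ΦNN (x k))
    have h3 := mul_le_mul_of_nonneg_left (hL _ (hD k)) hβ0
    refine (norm_sub_le _ _).trans ?_
    linarith
  intro k
  induction k with
  | zero => simp
  | succ k ih =>
    have h0 : 0 ≤ ϖ + β * L := by positivity
    calc ‖x (k + 1)‖ ≤ (ϖ + β * L) * ‖x k‖ := hstep k
      _ ≤ (ϖ + β * L) * ((ϖ + β * L) ^ k * ‖x 0‖) := mul_le_mul_of_nonneg_left ih h0
      _ = (ϖ + β * L) ^ (k + 1) * ‖x 0‖ := by ring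
end
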